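/- If the type inference algorithm succeeds with T(M) = (Γ, σ), where Γ ≡ (Γ', y₁:τ⃗₁, y₂:τ⃗₂), and the variable y does not occur in M, then T(M[y/y₁, y/y₂]) = (Γ'', σ) for some environment Γ'' with Γ'' ≡ (Γ', y:τ⃗₁ ∩ τ⃗₂) (types are considered equal up to renaming of type variables, and ≡ denotes equality of environments up to the order of declarations). -/

import Mathlib

/-! ## λ-terms -/

inductive Term : Type
  | var : ℕ → Term
  | lam : ℕ → Term → Term
  | app : Term → Term → Term

namespace Term

/-- free variables -/
def fv : Term → Finset ℕ
  | .var x => {x}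
  | .lam x M => fv M \ {x}
  | .app M N => fv M ∪ fv N

/-- all variables occurring in a term (free, bound or binding) -/
def allVars : Term → Finset ℕ
  | .var x => {x}
  | .lam x M => insert x (allVars M)
  | .app M N => allVars M ∪ allVars N

/-- substitution `M[N/x]` (as in the paper, under the variable convention) -/
def subst : Term → ℕ → Term → Term
  | .var y, x, N => if y = x then N else .var y
  | .lam y M, x, N => if y = x then .lam y M else .lam y (subst M x N)
  | .app M₁ M₂, x, N => .app (subst M₁ x N) (subst M₂ x N)

/-- simultaneous renaming `M[y₁/x₁, …, yₙ/xₙ]` (the `yᵢ` being fresh) -/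
def renList (M : Term) (xs ys : List ℕ) : Term :=
  (xs.zip ys).foldl (fun N q => N.subst q.1 (.var q.2)) M

/-- `M` is an abstraction -/
def IsAbs (M : Term) : Prop := ∃ x N, M = lam x N

end Term

/-! ## Linear types and linear rank 2 intersection types -/

/-- linear types (linear rank 0 intersection types) -/
inductive LTy : Type
  | var : ℕ → LTy
  | lolly : LTy → LTy → LTy

/-- type variables of a linear type -/
def LTy.tv : LTy → Finset ℕ
  | .var α => {α}
  | .lolly a b => a.tv ∪ b.tv

/-- linear rank 2 intersection types: `σ ::= τ | τ ⊸ σ | (τ₁ ∩ ⋯ ∩ τₙ) → σ`.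
Sequences (linear rank 1 types) are multisets of linear types (`∩` is associative,
commutative and non-idempotent); the constraint `n ≥ 2` on `arrow` is enforced in
the typing rules. -/
inductive Ty2 : Type
  | lin : LTy → Ty2
  | lolly : LTy → Ty2 → Ty2
  | arrow : Multiset LTy → Ty2 → Ty2

/-- `τ ⊸ σ`: identifies `τ ⊸ τ'` (for `τ'` linear) with the linear type `τ ⊸ τ'`,
so that every rank 2 type has a unique representation. -/
def Ty2.mkLolly (τ : LTy) : Ty2 → Ty2
  | .lin τ' => .lin (.lolly τ τ')
  | σ => .lolly τ σ

/-- type variables of a rank 2 type -/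
def Ty2.tv : Ty2 → Finset ℕ
  | .lin τ => τ.tv
  | .lolly τ σ => τ.tv ∪ σ.tv
  | .arrow A σ => (A.map LTy.tv).sup ∪ σ.tv

/-- type substitutions (mapping type variables to linear types) -/
abbrev TSub := ℕ → LTy

def LTy.applyS (S : TSub) : LTy → LTy
  | .var α => S α
  | .lolly a b => .lolly (a.applyS S) (b.applyS S)

def Ty2.applyS (S : TSub) : Ty2 → Ty2
  | .lin τ => .lin (τ.applyS S)
  | .lolly τ σ => .lolly (τ.applyS S) (σ.applyS S)
  | .arrow A σ => .arrow (A.map (LTy.applyS S)) (σ.applyS S)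

/-! ## Environments -/

section GEnv
variable {β : Type}

/-- the domain of an environment -/
def domG (Γ : List (ℕ × β)) : List ℕ := Γ.map Prod.fst

/-- a finite list of declarations is consistent iff the term variables are distinct -/
def consistentG (Γ : List (ℕ × β)) : Prop := (Γ.map Prod.fst).Nodup

/-- the predicate declared for `x` (defaulting to `0`, i.e. empty) -/
def lookupG [Zero β] (Γ : List (ℕ × β)) (x : ℕ) : β :=
  ((Γ.find? (fun p => p.1 == x)).map Prod.snd).getD 0

/-- `Γ₁ + Γ₂`: merge two environments, intersecting the predicates of common
variables; declarations of `Γ₁` come first, in order, followed by the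
declarations of variables only in `Γ₂`, in order. -/
def addG [Zero β] [Add β] (Γ₁ Γ₂ : List (ℕ × β)) : List (ℕ × β) :=
  Γ₁.map (fun p => (p.1, p.2 + lookupG Γ₂ p.1)) ++
    Γ₂.filter (fun p => !((Γ₁.map Prod.fst).contains p.1))

/-- `Σᵢ Γᵢ` -/
def sumG [Zero β] [Add β] (l : List (List (ℕ × β))) : List (ℕ × β) :=
  l.foldr addG []

/-- `Γ_x` : remove the declaration of `x` from `Γ` -/
def eraseG (Γ : List (ℕ × β)) (x : ℕ) : List (ℕ × β) :=
  Γ.filter (fun p => !(p.1 == x))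

/-- `Γ[y/x]` : rename the declared variable `x` to `y` -/
def renG (Γ : List (ℕ × β)) (x y : ℕ) : List (ℕ × β) :=
  Γ.map (fun p => (if p.1 = x then y else p.1, p.2))

/-- `Γ[y₁/x₁, …, yₙ/xₙ]` -/
def renListG (Γ : List (ℕ × β)) (xs ys : List ℕ) : List (ℕ × β) :=
  (xs.zip ys).foldl (fun Δ q => renG Δ q.1 q.2) Γ

end GEnv

/-- environments of the Linear Rank 2 Intersection Type System
(also called `T¹_L`-environments) -/
abbrev Env := List (ℕ × Multiset LTy)

/-- applying a type substitution to an environment -/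
def envApplyS (S : TSub) (Γ : Env) : Env :=
  Γ.map (fun p => (p.1, p.2.map (LTy.applyS S)))

/-- the type variables occurring in an environment -/
def envTv (Γ : Env) : Finset ℕ :=
  Γ.foldr (fun p acc => (p.2.map LTy.tv).sup ∪ acc) ∅

/-- the type variables occurring in a pair (environment, type) -/
def tvOf (Γ : Env) (σ : Ty2) : Finset ℕ := envTv Γ ∪ σ.tv

/-! ## The Linear Rank 2 Intersection Type System (with depth-indexed derivations) -/

/-- `DerN d Γ M σ`: there is a derivation of depth `d` of `Γ ⊢₂ M : σ`. -/
inductive DerN : ℕ → Env → Term → Ty2 → Prop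
  | ax (x : ℕ) (τ : LTy) :
      DerN 0 [(x, {τ})] (.var x) (.lin τ)
  | exch (d : ℕ) (Γ₁ Γ₂ : Env) (x y : ℕ) (A B : Multiset LTy) (M : Term) (σ : Ty2) :
      DerN d (Γ₁ ++ (x, A) :: (y, B) :: Γ₂) M σ →
      DerN (d + 1) (Γ₁ ++ (y, B) :: (x, A) :: Γ₂) M σ
  | contr (d : ℕ) (Γ₁ Γ₂ : Env) (x₁ x₂ x : ℕ) (A B : Multiset LTy) (M : Term) (σ : Ty2) :
      DerN d (Γ₁ ++ (x₁, A) :: (x₂, B) :: Γ₂) M σ →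
      x ∉ domG (Γ₁ ++ Γ₂) →
      DerN (d + 1) (Γ₁ ++ (x, A + B) :: Γ₂) ((M.subst x₁ (.var x)).subst x₂ (.var x)) σ
  | introArrow (d : ℕ) (Γ : Env) (x : ℕ) (A : Multiset LTy) (M : Term) (σ : Ty2) :
      DerN d (Γ ++ [(x, A)]) M σ →
      2 ≤ Multiset.card A →
      DerN (d + 1) Γ (.lam x M) (.arrow A σ)
  | introLolly (d : ℕ) (Γ : Env) (x : ℕ) (τ : LTy) (M : Term) (σ : Ty2) :
      DerN d (Γ ++ [(x, ({τ} : Multiset LTy))]) M σ →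
      DerN (d + 1) Γ (.lam x M) (Ty2.mkLolly τ σ)
  | elimLolly (d₁ d₂ : ℕ) (Γ₁ Γ₂ : Env) (M₁ M₂ : Term) (τ : LTy) (σ : Ty2) :
      DerN d₁ Γ₁ M₁ (Ty2.mkLolly τ σ) →
      DerN d₂ Γ₂ M₂ (.lin τ) →
      consistentG (Γ₁ ++ Γ₂) →
      DerN (max d₁ d₂ + 1) (Γ₁ ++ Γ₂) (.app M₁ M₂) σ
  | elimArrow (d : ℕ) (Γ : Env) (M₁ M₂ : Term) (σ : Ty2) (l : List (ℕ × Env × LTy)) :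
      DerN d Γ M₁ (.arrow (Multiset.ofList (l.map (fun p => p.2.2))) σ) →
      (∀ p ∈ l, DerN p.1 p.2.1 M₂ (.lin p.2.2)) →
      2 ≤ l.length →
      consistentG (Γ ++ sumG (l.map (fun p => p.2.1))) →
      DerN (max d ((l.map Prod.fst).foldr max 0) + 1)
        (Γ ++ sumG (l.map (fun p => p.2.1))) (.app M₁ M₂) σ

/-- `Γ ⊢₂ M : σ` in the Linear Rank 2 Intersection Type System. -/
def Der (Γ : Env) (M : Term) (σ : Ty2) : Prop := ∃ d, DerN d Γ M σ

/-! ## Unification and the type inference algorithm -/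

/-- `S` unifies all the equations of `P` -/
def Unifies (S : TSub) (P : List (LTy × LTy)) : Prop :=
  ∀ e ∈ P, LTy.applyS S e.1 = LTy.applyS S e.2

/-- `S` is a most general unifier of `P` -/
def IsMGU (S : TSub) (P : List (LTy × LTy)) : Prop :=
  Unifies S P ∧ ∀ S' : TSub, Unifies S' P →
    ∃ S'' : TSub, ∀ α, S' α = LTy.applyS S'' (S α)

/-- `Infer M Γ σ` : the type inference algorithm, run on `M`, may return `(Γ, σ)`
(fresh type variables are modelled by disjointness side conditions). -/
inductive Infer : Term → Env → Ty2 → Prop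
  | var (x α : ℕ) :
      Infer (.var x) [(x, {LTy.var α})] (.lin (.var α))
  | lamLolly {M₁ : Term} {Γ₁ : Env} {σ₁ : Ty2} (x : ℕ) (τ : LTy) :
      Infer M₁ Γ₁ σ₁ →
      (x, ({τ} : Multiset LTy)) ∈ Γ₁ →
      Infer (.lam x M₁) (eraseG Γ₁ x) (Ty2.mkLolly τ σ₁)
  | lamArrow {M₁ : Term} {Γ₁ : Env} {σ₁ : Ty2} (x : ℕ) (A : Multiset LTy) :
      Infer M₁ Γ₁ σ₁ →
      (x, A) ∈ Γ₁ →
      2 ≤ Multiset.card A →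
      Infer (.lam x M₁) (eraseG Γ₁ x) (.arrow A σ₁)
  | appVar {M₁ M₂ : Term} {Γ₁ Γ₂ : Env} (α₁ : ℕ) (τ₂ : LTy) (α₂ α₃ : ℕ) (S : TSub) :
      Infer M₁ Γ₁ (.lin (.var α₁)) →
      Infer M₂ Γ₂ (.lin τ₂) →
      Disjoint (tvOf Γ₁ (.lin (.var α₁))) (tvOf Γ₂ (.lin τ₂)) →
      α₂ ∉ tvOf Γ₁ (.lin (.var α₁)) ∪ tvOf Γ₂ (.lin τ₂) →
      α₃ ∉ tvOf Γ₁ (.lin (.var α₁)) ∪ tvOf Γ₂ (.lin τ₂) →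
      α₂ ≠ α₃ →
      IsMGU S [(LTy.var α₁, LTy.lolly (.var α₂) (.var α₃)), (τ₂, LTy.var α₂)] →
      Infer (.app M₁ M₂) (envApplyS S (addG Γ₁ Γ₂)) (.lin (S α₃))
  | appArrow {M₁ M₂ : Term} {Γ₁ : Env} {σ₁ : Ty2}
      (l : List (Env × LTy)) (ts : List LTy) (S : TSub) :
      Infer M₁ Γ₁ (.arrow (Multiset.ofList ts) σ₁) →
      (∀ p ∈ l, Infer M₂ p.1 (.lin p.2)) →
      l.length = ts.length →
      2 ≤ l.length →
      List.Pairwise (fun p q => Disjoint (tvOf p.1 (.lin p.2)) (tvOf q.1 (.lin q.2))) l →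
      (∀ p ∈ l, Disjoint (tvOf Γ₁ (.arrow (Multiset.ofList ts) σ₁)) (tvOf p.1 (.lin p.2))) →
      IsMGU S ((l.map Prod.snd).zip ts) →
      Infer (.app M₁ M₂) (envApplyS S (addG Γ₁ (sumG (l.map Prod.fst)))) (Ty2.applyS S σ₁)
  | appLolly {M₁ M₂ : Term} {Γ₁ Γ₂ : Env} (τ : LTy) (σ₁ : Ty2) (τ₂ : LTy) (S : TSub) :
      Infer M₁ Γ₁ (Ty2.mkLolly τ σ₁) →
      Infer M₂ Γ₂ (.lin τ₂) →
      Disjoint (tvOf Γ₁ (Ty2.mkLolly τ σ₁)) (tvOf Γ₂ (.lin τ₂)) →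
      IsMGU S [(τ₂, τ)] →
      Infer (.app M₁ M₂) (envApplyS S (addG Γ₁ Γ₂)) (Ty2.applyS S σ₁)

/-! ## Multi-types and the Linear Rank 2 Quantitative Type System -/

/-- rank 0 multi-types: `t ::= Neutral | Abs | α | t ⊸ t` -/
inductive MTy : Type
  | Neutral : MTy
  | Abs : MTy
  | var : ℕ → MTy
  | lolly : MTy → MTy → MTy

/-- rank 2 multi-types (rank 1 multi-types are multisets of rank 0 multi-types) -/
inductive MTy2 : Type
  | base : MTy → MTy2
  | lolly : MTy → MTy2 → MTy2
  | arrow : Multiset MTy → MTy2 → MTy2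

/-- `t ⊸ s`, identifying `t ⊸ t'` with the rank 0 multi-type `t ⊸ t'` -/
def MTy2.mkLolly (t : MTy) : MTy2 → MTy2
  | .base t' => .base (.lolly t t')
  | s => .lolly t s

/-- a rank 0 multi-type is tight iff it is one of the tight constants -/
def MTy.tight (t : MTy) : Prop := t = .Neutral ∨ t = .Abs

/-- a rank 1 multi-type is tight iff all its components are -/
def tightSeq (ts : Multiset MTy) : Prop := ∀ t ∈ ts, MTy.tight t

/-- a rank 2 multi-type is tight iff it is a tight constant -/
def MTy2.tight (s : MTy2) : Prop := s = .base .Neutral ∨ s = .base .Abs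

/-- environments of the quantitative system: each declaration carries a pair
(sequence of linear types, rank 1 multi-type) -/
abbrev QEnv := List (ℕ × (Multiset LTy × Multiset MTy))

/-- a quantitative environment is tight iff all its multi-type components are -/
def tightE (Γ : QEnv) : Prop := ∀ p ∈ Γ, tightSeq p.2.2

/-- the Linear Rank 2 Quantitative Type System: `QDer Γ b M σ s` is
`Γ ⊢^b M : σ | s`. -/
inductive QDer : QEnv → ℕ → Term → Ty2 → MTy2 → Prop
  | ax (x : ℕ) (τ : LTy) (t : MTy) :
      QDer [(x, ({τ}, {t}))] 0 (.var x) (.lin τ) (.base t)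
  | exch (Γ₁ Γ₂ : QEnv) (x y : ℕ) (A B : Multiset LTy × Multiset MTy)
      (b : ℕ) (M : Term) (σ : Ty2) (s : MTy2) :
      QDer (Γ₁ ++ (x, A) :: (y, B) :: Γ₂) b M σ s →
      QDer (Γ₁ ++ (y, B) :: (x, A) :: Γ₂) b M σ s
  | contr (Γ₁ Γ₂ : QEnv) (x₁ x₂ x : ℕ) (A₁ A₂ : Multiset LTy × Multiset MTy)
      (b : ℕ) (M : Term) (σ : Ty2) (s : MTy2) :
      QDer (Γ₁ ++ (x₁, A₁) :: (x₂, A₂) :: Γ₂) b M σ s →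
      x ∉ domG (Γ₁ ++ Γ₂) →
      QDer (Γ₁ ++ (x, A₁ + A₂) :: Γ₂) b ((M.subst x₁ (.var x)).subst x₂ (.var x)) σ s
  | introLolly (Γ : QEnv) (x : ℕ) (τ : LTy) (t : MTy) (b : ℕ) (M : Term) (σ : Ty2) (s : MTy2) :
      QDer (Γ ++ [(x, ({τ}, {t}))]) b M σ s →
      QDer Γ (b + 1) (.lam x M) (Ty2.mkLolly τ σ) (MTy2.mkLolly t s)
  | introLollyT (Γ : QEnv) (x : ℕ) (τ : LTy) (t : MTy) (b : ℕ) (M : Term) (σ : Ty2) (s : MTy2) :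
      QDer (Γ ++ [(x, ({τ}, {t}))]) b M σ s →
      MTy.tight t →
      MTy2.tight s →
      QDer Γ b (.lam x M) (Ty2.mkLolly τ σ) (.base .Abs)
  | introArrow (Γ : QEnv) (x : ℕ) (A : Multiset LTy) (ts : Multiset MTy)
      (b : ℕ) (M : Term) (σ : Ty2) (s : MTy2) :
      QDer (Γ ++ [(x, (A, ts))]) b M σ s →
      2 ≤ Multiset.card A →
      Multiset.card ts = Multiset.card A →
      QDer Γ (b + 1) (.lam x M) (.arrow A σ) (.arrow ts s)
  | introArrowT (Γ : QEnv) (x : ℕ) (A : Multiset LTy) (ts : Multiset MTy)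
      (b : ℕ) (M : Term) (σ : Ty2) (s : MTy2) :
      QDer (Γ ++ [(x, (A, ts))]) b M σ s →
      2 ≤ Multiset.card A →
      tightSeq ts →
      MTy2.tight s →
      QDer Γ b (.lam x M) (.arrow A σ) (.base .Abs)
  | elimLolly (Γ₁ Γ₂ : QEnv) (b₁ b₂ : ℕ) (M₁ M₂ : Term) (τ : LTy) (σ : Ty2) (t : MTy) (s : MTy2) :
      QDer Γ₁ b₁ M₁ (Ty2.mkLolly τ σ) (MTy2.mkLolly t s) →
      QDer Γ₂ b₂ M₂ (.lin τ) (.base t) →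
      consistentG (Γ₁ ++ Γ₂) →
      QDer (Γ₁ ++ Γ₂) (b₁ + b₂) (.app M₁ M₂) σ s
  | elimLollyT (Γ₁ Γ₂ : QEnv) (b₁ b₂ : ℕ) (M₁ M₂ : Term) (τ : LTy) (σ : Ty2) (s₂ : MTy2) :
      QDer Γ₁ b₁ M₁ (Ty2.mkLolly τ σ) (.base .Neutral) →
      QDer Γ₂ b₂ M₂ (.lin τ) s₂ →
      MTy2.tight s₂ →
      consistentG (Γ₁ ++ Γ₂) →
      QDer (Γ₁ ++ Γ₂) (b₁ + b₂) (.app M₁ M₂) σ (.base .Neutral)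
  | elimArrow (Γ : QEnv) (b : ℕ) (M₁ M₂ : Term) (σ : Ty2) (s : MTy2)
      (l : List (QEnv × ℕ × LTy × MTy)) :
      QDer Γ b M₁ (.arrow (Multiset.ofList (l.map (fun p => p.2.2.1))) σ)
        (.arrow (Multiset.ofList (l.map (fun p => p.2.2.2))) s) →
      (∀ p ∈ l, QDer p.1 p.2.1 M₂ (.lin p.2.2.1) (.base p.2.2.2)) →
      2 ≤ l.length →
      consistentG (Γ ++ sumG (l.map Prod.fst)) →
      QDer (Γ ++ sumG (l.map Prod.fst)) (b + (l.map (fun p => p.2.1)).sum) (.app M₁ M₂) σ s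
  | elimArrowT (Γ : QEnv) (b : ℕ) (M₁ M₂ : Term) (σ : Ty2)
      (l : List (QEnv × ℕ × LTy × MTy2)) :
      QDer Γ b M₁ (.arrow (Multiset.ofList (l.map (fun p => p.2.2.1))) σ) (.base .Neutral) →
      (∀ p ∈ l, QDer p.1 p.2.1 M₂ (.lin p.2.2.1) p.2.2.2) →
      (∀ p ∈ l, MTy2.tight p.2.2.2) →
      2 ≤ l.length →
      consistentG (Γ ++ sumG (l.map Prod.fst)) →
      QDer (Γ ++ sumG (l.map Prod.fst)) (b + (l.map (fun p => p.2.1)).sum)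
        (.app M₁ M₂) σ (.base .Neutral)

/-! ## Leftmost-outermost normal forms and evaluation -/

namespace Term

mutual
  /-- leftmost-outermost neutral terms -/
  inductive Neutral : Term → Prop
    | var (x : ℕ) : Neutral (.var x)
    | app {M N : Term} : Neutral M → Normal N → Neutral (.app M N)
  /-- leftmost-outermost normal terms -/
  inductive Normal : Term → Prop
    | of_neutral {M : Term} : Neutral M → Normal M
    | lam (x : ℕ) {M : Term} : Normal M → Normal (.lam x M)
end

/-- one step of the leftmost-outermost evaluation strategy -/
inductive Step : Term → Term → Prop
  | beta (x : ℕ) (M N : Term) : Step (.app (.lam x M) N) (M.subst x N)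
  | lam (x : ℕ) {M M' : Term} : Step M M' → Step (.lam x M) (.lam x M')
  | appL {M M' N : Term} : Step M M' → ¬ IsAbs M → Step (.app M N) (.app M' N)
  | appR {N M M' : Term} : Neutral N → Step M M' → Step (.app N M) (.app N M')

/-- `StepsN b M N` : `M ⟶^b N`, i.e. `M` reduces to `N` in exactly `b`
leftmost-outermost steps -/
inductive StepsN : ℕ → Term → Term → Prop
  | refl (M : Term) : StepsN 0 M M
  | step {M M' N : Term} {b : ℕ} : Step M M' → StepsN b M' N → StepsN (b + 1) M N

end Term

/-! ## Quantitative unification and the quantitative type inference algorithm -/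

/-- `[τ/α]` applied to a linear type -/
def substVar (τ : LTy) (α : ℕ) : LTy → LTy
  | .var β => if β = α then τ else .var β
  | .lolly a b => .lolly (substVar τ α a) (substVar τ α b)

/-- `[τ/α]` applied to a unification problem -/
def substEqs (τ : LTy) (α : ℕ) (P : Multiset (LTy × LTy)) : Multiset (LTy × LTy) :=
  P.map (fun e => (substVar τ α e.1, substVar τ α e.2))

/-- `α` occurs in the unification problem `P` -/
def occursIn (α : ℕ) (P : Multiset (LTy × LTy)) : Prop :=
  ∃ e ∈ P, α ∈ e.1.tv ∨ α ∈ e.2.tv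

/-- one transformation step `P ⇒ P'` on unification problems; the third component
is `1` for a decomposition step `{τ₁ ⊸ τ₂ = τ₃ ⊸ τ₄} ∪ P ⇒ {τ₁ = τ₃, τ₂ = τ₄} ∪ P`
and `0` otherwise -/
inductive UStep : Multiset (LTy × LTy) → Multiset (LTy × LTy) → ℕ → Prop
  | del (τ : LTy) (P : Multiset (LTy × LTy)) :
      UStep ((τ, τ) ::ₘ P) P 0
  | dec (a b c d : LTy) (P : Multiset (LTy × LTy)) :
      UStep ((LTy.lolly a b, LTy.lolly c d) ::ₘ P) ((a, c) ::ₘ (b, d) ::ₘ P) 1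
  | swap (a b : LTy) (α : ℕ) (P : Multiset (LTy × LTy)) :
      UStep ((LTy.lolly a b, LTy.var α) ::ₘ P) ((LTy.var α, LTy.lolly a b) ::ₘ P) 0
  | elim (α : ℕ) (τ : LTy) (P : Multiset (LTy × LTy)) :
      occursIn α P →
      α ∉ τ.tv →
      UStep ((LTy.var α, τ) ::ₘ P) ((LTy.var α, τ) ::ₘ substEqs τ α P) 0

/-- iterated transformation steps, accumulating the number of decompositions -/
inductive URun : Multiset (LTy × LTy) → Multiset (LTy × LTy) → ℕ → Prop
  | refl (P : Multiset (LTy × LTy)) : URun P P 0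
  | step {P Q R : Multiset (LTy × LTy)} {k b : ℕ} :
      UStep P Q k → URun Q R b → URun P R (k + b)

/-- `P` is in solved form, inducing the substitution `S` -/
def SolvedWith (P : Multiset (LTy × LTy)) (S : TSub) : Prop :=
  ∃ L : List (ℕ × LTy),
    Multiset.ofList (L.map (fun p => (LTy.var p.1, p.2))) = P ∧
    (L.map Prod.fst).Nodup ∧
    (∀ p ∈ L, ∀ q ∈ L, p.1 ∉ q.2.tv) ∧
    S = fun β => (((L.find? (fun p => p.1 == β)).map Prod.snd).getD (LTy.var β))

/-- `UNIFY_Q(P) = (S, b)`: the quantitative unification algorithm succeeds on `P`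
returning the most general unifier `S` and the number `b` of decomposition steps -/
def UnifyQ (P : Multiset (LTy × LTy)) (S : TSub) (b : ℕ) : Prop :=
  ∃ P', URun P P' b ∧ (∀ Q k, ¬ UStep P' Q k) ∧ SolvedWith P' S

/-- `QInfer M Γ σ b` : the quantitative type inference algorithm `T_Q`, run on
`M`, may return `(Γ, σ, b)`. -/
inductive QInfer : Term → Env → Ty2 → ℕ → Prop
  | var (x α : ℕ) :
      QInfer (.var x) [(x, {LTy.var α})] (.lin (.var α)) 0
  | lamLolly {M₁ : Term} {Γ₁ : Env} {σ₁ : Ty2} {b₁ : ℕ} (x : ℕ) (τ : LTy) :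
      QInfer M₁ Γ₁ σ₁ b₁ →
      (x, ({τ} : Multiset LTy)) ∈ Γ₁ →
      QInfer (.lam x M₁) (eraseG Γ₁ x) (Ty2.mkLolly τ σ₁) b₁
  | lamArrow {M₁ : Term} {Γ₁ : Env} {σ₁ : Ty2} {b₁ : ℕ} (x : ℕ) (A : Multiset LTy) :
      QInfer M₁ Γ₁ σ₁ b₁ →
      (x, A) ∈ Γ₁ →
      2 ≤ Multiset.card A →
      QInfer (.lam x M₁) (eraseG Γ₁ x) (.arrow A σ₁) b₁
  | appVar {M₁ M₂ : Term} {Γ₁ Γ₂ : Env} {b₁ b₂ : ℕ}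
      (α₁ : ℕ) (τ₂ : LTy) (α₂ α₃ : ℕ) (S : TSub) (bu : ℕ) :
      QInfer M₁ Γ₁ (.lin (.var α₁)) b₁ →
      QInfer M₂ Γ₂ (.lin τ₂) b₂ →
      Disjoint (tvOf Γ₁ (.lin (.var α₁))) (tvOf Γ₂ (.lin τ₂)) →
      α₂ ∉ tvOf Γ₁ (.lin (.var α₁)) ∪ tvOf Γ₂ (.lin τ₂) →
      α₃ ∉ tvOf Γ₁ (.lin (.var α₁)) ∪ tvOf Γ₂ (.lin τ₂) →
      α₂ ≠ α₃ →
      UnifyQ {(LTy.var α₁, LTy.lolly (.var α₂) (.var α₃)), (τ₂, LTy.var α₂)} S bu →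
      QInfer (.app M₁ M₂) (envApplyS S (addG Γ₁ Γ₂)) (.lin (S α₃)) (b₁ + b₂)
  | appArrow {M₁ M₂ : Term} {Γ₁ : Env} {σ₁ : Ty2} {b₁ : ℕ}
      (l : List (Env × LTy × ℕ)) (ts : List LTy) (S : TSub) (bu : ℕ) :
      QInfer M₁ Γ₁ (.arrow (Multiset.ofList ts) σ₁) b₁ →
      (∀ p ∈ l, QInfer M₂ p.1 (.lin p.2.1) p.2.2) →
      l.length = ts.length →
      2 ≤ l.length →
      List.Pairwise (fun p q => Disjoint (tvOf p.1 (.lin p.2.1)) (tvOf q.1 (.lin q.2.1))) l →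
      (∀ p ∈ l, Disjoint (tvOf Γ₁ (.arrow (Multiset.ofList ts) σ₁)) (tvOf p.1 (.lin p.2.1))) →
      UnifyQ (Multiset.ofList ((l.map (fun p => p.2.1)).zip ts)) S bu →
      QInfer (.app M₁ M₂) (envApplyS S (addG Γ₁ (sumG (l.map Prod.fst)))) (Ty2.applyS S σ₁)
        (b₁ + (l.map (fun p => p.2.2)).sum + bu + 1)
  | appLolly {M₁ M₂ : Term} {Γ₁ Γ₂ : Env} {b₁ b₂ : ℕ}
      (τ : LTy) (σ₁ : Ty2) (τ₂ : LTy) (S : TSub) (bu : ℕ) :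
      QInfer M₁ Γ₁ (Ty2.mkLolly τ σ₁) b₁ →
      QInfer M₂ Γ₂ (.lin τ₂) b₂ →
      Disjoint (tvOf Γ₁ (Ty2.mkLolly τ σ₁)) (tvOf Γ₂ (.lin τ₂)) →
      UnifyQ {(τ₂, τ)} S bu →
      QInfer (.app M₁ M₂) (envApplyS S (addG Γ₁ Γ₂)) (Ty2.applyS S σ₁) (b₁ + b₂ + bu + 1)

/-! ## Renaming a free variable in the inference algorithm -/

/-- the bound variables of a term -/
def Term.boundVars : Term → Finset ℕ
  | .var _ => ∅
  | .lam x M => insert x (boundVars M)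
  | .app M N => boundVars M ∪ boundVars N

theorem Term.boundVars_subset_allVars (M : Term) : M.boundVars ⊆ M.allVars := by
  induction M with
  | var x => simp [boundVars]
  | lam x M ih => exact Finset.insert_subset_insert _ ih
  | app M N ih₁ ih₂ => exact Finset.union_subset_union ih₁ ih₂

theorem Term.boundVars_subst_var (M : Term) (z y : ℕ) :
    (M.subst z (.var y)).boundVars = M.boundVars := by
  induction M with
  | var x => by_cases h : x = z <;> simp [subst, boundVars, h]
  | lam x M ih => by_cases h : x = z <;> simp [subst, boundVars, h, ih]
  | app M N ih₁ ih₂ => simp [subst, boundVars, ih₁, ih₂]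

/-- an environment is proper when its variables are distinct and its sequences nonempty -/
def Env.Proper (Γ : Env) : Prop := (domG Γ).Nodup ∧ ∀ p ∈ Γ, p.2 ≠ 0

/-- the multiset of all pairs `(x, τ)` such that `τ` is a component of the sequence of `x` -/
def Env.flat (Γ : Env) : Multiset (ℕ × LTy) :=
  (Γ.map fun p => p.2.map (Prod.mk p.1)).sum

/-- `z` renamed to `y` in the first component of a pair -/
def renamePair (z y : ℕ) (p : ℕ × LTy) : ℕ × LTy := (if p.1 = z then y else p.1, p.2)

section Lookup

variable {β : Type}

theorem domG_addG [Zero β] [Add β] (Γ₁ Γ₂ : List (ℕ × β)) :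
    domG (addG Γ₁ Γ₂) = domG Γ₁ ++ (domG Γ₂).filter (fun x => !((domG Γ₁).contains x)) := by
  simp [domG, addG, List.filter_map, Function.comp_def]

theorem lookupG_cons [Zero β] (a x : ℕ) (b : β) (Γ : List (ℕ × β)) :
    lookupG ((a, b) :: Γ) x = if a = x then b else lookupG Γ x := by
  by_cases h : a = x <;> simp [lookupG, h]

theorem lookupG_eq_zero [Zero β] {Γ : List (ℕ × β)} {x : ℕ} (h : x ∉ domG Γ) :
    lookupG Γ x = 0 := by
  induction Γ with
  | nil => rfl
  | cons p Γ ih =>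
    obtain ⟨a, b⟩ := p
    simp only [domG, List.map_cons, List.mem_cons, not_or] at h
    rw [lookupG_cons, if_neg (Ne.symm h.1), ih h.2]

theorem lookupG_of_mem [Zero β] {Γ : List (ℕ × β)} {x : ℕ} {b : β} (hΓ : (domG Γ).Nodup)
    (h : (x, b) ∈ Γ) : lookupG Γ x = b := by
  induction Γ with
  | nil => simp at h
  | cons p Γ ih =>
    obtain ⟨a, c⟩ := p
    simp only [domG, List.map_cons, List.nodup_cons] at hΓ
    rw [lookupG_cons]
    rcases List.mem_cons.1 h with h | h
    · simp_all
    · have : a ≠ x := by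
        rintro rfl
        exact hΓ.1 (List.mem_map.2 ⟨_, h, rfl⟩)
      rw [if_neg this, ih hΓ.2 h]

theorem mem_of_lookupG_ne_zero [Zero β] {Γ : List (ℕ × β)} {x : ℕ} (h : lookupG Γ x ≠ 0) :
    (x, lookupG Γ x) ∈ Γ := by
  induction Γ with
  | nil => exact absurd rfl h
  | cons p Γ ih =>
    obtain ⟨a, b⟩ := p
    rw [lookupG_cons] at h ⊢
    split_ifs at h ⊢ with hx
    · simp [hx]
    · exact List.mem_cons_of_mem _ (ih h)

theorem lookupG_append [Zero β] (Γ₁ Γ₂ : List (ℕ × β)) (x : ℕ) :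
    lookupG (Γ₁ ++ Γ₂) x = if x ∈ domG Γ₁ then lookupG Γ₁ x else lookupG Γ₂ x := by
  induction Γ₁ with
  | nil => simp [domG]
  | cons p Γ ih =>
    obtain ⟨a, b⟩ := p
    simp only [List.cons_append, lookupG_cons, ih, domG, List.map_cons, List.mem_cons]
    grind

theorem lookupG_filter [Zero β] (q : ℕ → Bool) (Γ : List (ℕ × β)) (x : ℕ) :
    lookupG (Γ.filter fun p => q p.1) x = if q x then lookupG Γ x else 0 := by
  induction Γ with
  | nil => simp [lookupG]
  | cons p Γ ih =>
    obtain ⟨a, b⟩ := p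
    by_cases ha : q a <;> simp only [List.filter_cons, ha, if_true, lookupG_cons, ih] <;> grind

theorem lookupG_map_add [Zero β] [Add β] (g : ℕ → β) (Γ : List (ℕ × β)) (x : ℕ) :
    lookupG (Γ.map fun p => (p.1, p.2 + g p.1)) x =
      if x ∈ domG Γ then lookupG Γ x + g x else 0 := by
  induction Γ with
  | nil => simp [lookupG, domG]
  | cons p Γ ih =>
    obtain ⟨a, b⟩ := p
    simp only [List.map_cons, lookupG_cons, ih, domG, List.mem_cons]
    grind

theorem lookupG_addG [AddZeroClass β] (Γ₁ Γ₂ : List (ℕ × β)) (x : ℕ) :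
    lookupG (addG Γ₁ Γ₂) x = lookupG Γ₁ x + lookupG Γ₂ x := by
  unfold addG
  rw [lookupG_append, lookupG_map_add,
    lookupG_filter (fun a => !((Γ₁.map Prod.fst).contains a))]
  have hd : domG (Γ₁.map fun p => (p.1, p.2 + lookupG Γ₂ p.1)) = domG Γ₁ := by
    simp [domG, Function.comp_def]
  rw [hd]
  by_cases h : x ∈ domG Γ₁
  · simp [h]
  · have h' : (Γ₁.map Prod.fst).contains x = false := by simpa [domG] using h
    simp only [h, if_false, h', Bool.not_false, if_true, lookupG_eq_zero h, zero_add]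

end Lookup

namespace Env

theorem flat_cons (p : ℕ × Multiset LTy) (Γ : Env) :
    flat (p :: Γ) = p.2.map (Prod.mk p.1) + flat Γ := by
  simp [flat]

theorem flat_append (Γ₁ Γ₂ : Env) : flat (Γ₁ ++ Γ₂) = flat Γ₁ + flat Γ₂ := by
  simp [flat]

theorem flat_perm {Γ₁ Γ₂ : Env} (h : Γ₁.Perm Γ₂) : flat Γ₁ = flat Γ₂ :=
  (h.map _).sum_eq

theorem mem_flat {Γ : Env} {q : ℕ × LTy} : q ∈ flat Γ ↔ ∃ p ∈ Γ, p.1 = q.1 ∧ q.2 ∈ p.2 := by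
  induction Γ with
  | nil => simp [flat]
  | cons p Γ ih =>
    obtain ⟨a, b⟩ := q
    simp only [flat_cons, Multiset.mem_add, ih, Multiset.mem_map, List.mem_cons, exists_eq_or_imp,
      Prod.mk.injEq]
    grind

theorem mem_domG_of_mem_flat {Γ : Env} {q : ℕ × LTy} (h : q ∈ flat Γ) : q.1 ∈ domG Γ := by
  obtain ⟨p, hp, hpq, -⟩ := mem_flat.1 h
  exact List.mem_map.2 ⟨p, hp, hpq⟩

open Classical in
theorem count_flat {Γ : Env} (hΓ : (domG Γ).Nodup) (q : ℕ × LTy) :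
    (flat Γ).count q = (lookupG Γ q.1).count q.2 := by
  induction Γ with
  | nil => simp [flat, lookupG]
  | cons p Γ ih =>
    obtain ⟨a, A⟩ := p
    obtain ⟨x, τ⟩ := q
    simp only [domG, List.map_cons, List.nodup_cons] at hΓ
    rw [flat_cons, Multiset.count_add, ih hΓ.2, lookupG_cons]
    by_cases h : a = x
    · subst h
      rw [lookupG_eq_zero hΓ.1, if_pos rfl,
        Multiset.count_map_eq_count' _ _ (Prod.mk_right_injective a)]
      simp
    · rw [if_neg h, Multiset.count_eq_zero_of_notMem]
      · simp
      · simp [h]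

theorem lookupG_eq_of_flat_eq {Γ₁ Γ₂ : Env} (h₁ : (domG Γ₁).Nodup) (h₂ : (domG Γ₂).Nodup)
    (h : flat Γ₁ = flat Γ₂) (x : ℕ) : lookupG Γ₁ x = lookupG Γ₂ x := by
  classical
  ext τ
  rw [← count_flat h₁ (x, τ), ← count_flat h₂ (x, τ), h]

theorem flat_addG {Γ₁ Γ₂ : Env} (h₁ : (domG Γ₁).Nodup) (h₂ : (domG Γ₂).Nodup)
    (h : (domG (addG Γ₁ Γ₂)).Nodup) : flat (addG Γ₁ Γ₂) = flat Γ₁ + flat Γ₂ := by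
  classical
  ext q
  rw [Multiset.count_add, count_flat h, count_flat h₁, count_flat h₂, lookupG_addG,
    Multiset.count_add]

theorem Proper.mem_iff {Γ : Env} (hΓ : Γ.Proper) {x : ℕ} {A : Multiset LTy} :
    (x, A) ∈ Γ ↔ lookupG Γ x = A ∧ A ≠ 0 := by
  refine ⟨fun h => ⟨lookupG_of_mem hΓ.1 h, hΓ.2 _ h⟩, ?_⟩
  rintro ⟨rfl, h⟩
  exact mem_of_lookupG_ne_zero h

theorem Proper.perm_of_flat_eq {Γ₁ Γ₂ : Env} (h₁ : Γ₁.Proper) (h₂ : Γ₂.Proper)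
    (h : flat Γ₁ = flat Γ₂) : Γ₁.Perm Γ₂ := by
  refine (List.perm_ext_iff_of_nodup (List.Nodup.of_map _ h₁.1) (List.Nodup.of_map _ h₂.1)).2 ?_
  rintro ⟨x, A⟩
  rw [h₁.mem_iff, h₂.mem_iff, lookupG_eq_of_flat_eq h₁.1 h₂.1 h]

theorem Proper.perm {Γ₁ Γ₂ : Env} (h₁ : Γ₁.Proper) (h : Γ₁.Perm Γ₂) : Γ₂.Proper :=
  ⟨(h.map _).nodup_iff.1 h₁.1, fun p hp => h₁.2 p (h.mem_iff.2 hp)⟩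

theorem Proper.addG {Γ₁ Γ₂ : Env} (h₁ : Γ₁.Proper) (h₂ : Γ₂.Proper) :
    Proper (addG Γ₁ Γ₂) := by
  constructor
  · rw [domG_addG]
    refine List.Nodup.append h₁.1 (h₂.1.filter _) ?_
    intro x hx hx'
    simp [hx] at hx'
  · intro p hp
    rcases List.mem_append.1 hp with hp | hp
    · obtain ⟨q, hq, rfl⟩ := List.mem_map.1 hp
      have := h₁.2 q hq
      simp [this]
    · exact h₂.2 p (List.mem_filter.1 hp).1

theorem Proper.flat_addG {Γ₁ Γ₂ : Env} (h₁ : Γ₁.Proper) (h₂ : Γ₂.Proper) :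
    flat (_root_.addG Γ₁ Γ₂) = flat Γ₁ + flat Γ₂ :=
  Env.flat_addG h₁.1 h₂.1 (h₁.addG h₂).1

theorem Proper.sumG {l : List Env} (h : ∀ Γ ∈ l, Proper Γ) : Proper (sumG l) := by
  induction l with
  | nil => simp [_root_.sumG, Proper, domG]
  | cons Γ l ih =>
    rw [List.forall_mem_cons] at h
    exact h.1.addG (ih h.2)

theorem flat_sumG {l : List Env} (h : ∀ Γ ∈ l, Proper Γ) :
    flat (sumG l) = (l.map flat).sum := by
  induction l with
  | nil => simp [sumG, flat]
  | cons Γ l ih =>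
    rw [List.forall_mem_cons] at h
    rw [List.map_cons, List.sum_cons, ← ih h.2]
    exact h.1.flat_addG (Proper.sumG h.2)

theorem Proper.eraseG {Γ : Env} (h : Γ.Proper) (x : ℕ) : Proper (eraseG Γ x) :=
  ⟨h.1.sublist (List.filter_sublist.map _), fun p hp => h.2 p (List.mem_filter.1 hp).1⟩

theorem flat_eraseG (Γ : Env) (x : ℕ) :
    flat (eraseG Γ x) = (flat Γ).filter (fun q => q.1 ≠ x) := by
  induction Γ with
  | nil => simp [flat, eraseG]
  | cons p Γ ih =>
    obtain ⟨a, A⟩ := p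
    unfold eraseG at ih ⊢
    rw [flat_cons, Multiset.filter_add, ← ih, List.filter_cons]
    by_cases h : a = x
    · simp [h, Multiset.filter_map]
    · simp [h, Multiset.filter_map, flat_cons]

theorem Proper.envApplyS {Γ : Env} (h : Γ.Proper) (S : TSub) : Proper (envApplyS S Γ) := by
  constructor
  · have := h.1
    simpa [domG, _root_.envApplyS, Function.comp_def] using this
  · intro p hp
    obtain ⟨q, hq, rfl⟩ := List.mem_map.1 hp
    have := h.2 q hq
    simpa using this

theorem flat_envApplyS (S : TSub) (Γ : Env) :
    flat (envApplyS S Γ) = (flat Γ).map (fun q => (q.1, q.2.applyS S)) := by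
  induction Γ with
  | nil => simp [flat, envApplyS]
  | cons p Γ ih =>
    unfold envApplyS at ih ⊢
    simp [flat_cons, ih]

theorem flat_envApplyS_rename {Γ Δ : Env} (S : TSub) (z y : ℕ)
    (h : flat Δ = (flat Γ).map (renamePair z y)) :
    flat (envApplyS S Δ) = (flat (envApplyS S Γ)).map (renamePair z y) := by
  rw [flat_envApplyS, flat_envApplyS, h, Multiset.map_map, Multiset.map_map]
  rfl

theorem mem_envTv {Γ : Env} {α : ℕ} : α ∈ envTv Γ ↔ ∃ q ∈ flat Γ, α ∈ q.2.tv := by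
  have hsup (A : Multiset LTy) : α ∈ (A.map LTy.tv).sup ↔ ∃ τ ∈ A, α ∈ τ.tv := by
    induction A using Multiset.induction_on with
    | empty => simp
    | cons τ A ih => simp [ih]
  induction Γ with
  | nil => simp [envTv, flat]
  | cons p Γ ih =>
    have hcons : envTv (p :: Γ) = (p.2.map LTy.tv).sup ∪ envTv Γ := rfl
    rw [hcons, Finset.mem_union, hsup, flat_cons]
    refine (or_congr_right ih).trans ?_
    simp only [Multiset.mem_add, Multiset.mem_map, or_and_right, exists_or]
    simp

theorem tvOf_rename {Γ Δ : Env} {z y : ℕ} (h : flat Δ = (flat Γ).map (renamePair z y)) (σ : Ty2) :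
    tvOf Δ σ = tvOf Γ σ := by
  have : envTv Δ = envTv Γ := by
    ext α
    simp only [mem_envTv, h, Multiset.mem_map, exists_exists_and_eq_and, renamePair]
  rw [tvOf, this, tvOf]

theorem lookupG_rename {Γ Δ : Env} (hΓ : Γ.Proper) (hΔ : Δ.Proper) {x y z : ℕ}
    (h : flat Δ = (flat Γ).map (renamePair z y)) (hz : x ≠ z) (hy : x ≠ y) :
    lookupG Δ x = lookupG Γ x := by
  classical
  ext τ
  rw [← count_flat hΔ.1 (x, τ), ← count_flat hΓ.1 (x, τ), h, Multiset.count_map,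
    Multiset.count, Multiset.countP_eq_card_filter]
  congr 1
  refine Multiset.filter_congr ?_
  rintro ⟨a, b⟩ -
  simp only [renamePair, Prod.mk.injEq]
  split_ifs <;> grind

theorem flat_eraseG_rename {Γ Δ : Env} {x y z : ℕ}
    (h : flat Δ = (flat Γ).map (renamePair z y)) (hz : x ≠ z) (hy : x ≠ y) :
    flat (eraseG Δ x) = (flat (eraseG Γ x)).map (renamePair z y) := by
  rw [flat_eraseG, flat_eraseG, h, Multiset.filter_map]
  congr 1
  refine Multiset.filter_congr ?_
  rintro ⟨a, b⟩ -
  simp only [renamePair, Function.comp_apply]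
  split_ifs <;> grind

theorem map_renamePair_of_notMem {Γ : Env} {z : ℕ} (y : ℕ) (h : z ∉ domG Γ) :
    (flat Γ).map (renamePair z y) = flat Γ := by
  conv_rhs => rw [← Multiset.map_id (flat Γ)]
  refine Multiset.map_congr rfl fun q hq => ?_
  have : q.1 ≠ z := by
    rintro rfl
    exact h (mem_domG_of_mem_flat hq)
  simp [renamePair, this]

theorem notMem_domG_eraseG (Γ : Env) (x : ℕ) : x ∉ domG (eraseG Γ x) := by
  simp [domG, eraseG]

end Env

open Env

theorem Infer.proper {M : Term} {Γ : Env} {σ : Ty2} (h : Infer M Γ σ) : Γ.Proper := by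
  induction h with
  | var x α => simp [Env.Proper, domG]
  | lamLolly x _ _ _ ih => exact ih.eraseG x
  | lamArrow x _ _ _ _ ih => exact ih.eraseG x
  | appVar _ _ _ _ S _ _ _ _ _ _ _ ih₁ ih₂ => exact (ih₁.addG ih₂).envApplyS S
  | appArrow l _ S _ _ _ _ _ _ _ ih₁ ih₂ =>
    refine (ih₁.addG (Proper.sumG ?_)).envApplyS S
    simpa using fun Γ τ hp => ih₂ (Γ, τ) hp
  | appLolly _ _ _ S _ _ _ _ ih₁ ih₂ => exact (ih₁.addG ih₂).envApplyS S

theorem domG_envApplyS (S : TSub) (Γ : Env) : domG (envApplyS S Γ) = domG Γ := by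
  simp [domG, envApplyS, Function.comp_def]

theorem mem_domG_addG {β : Type} [Zero β] [Add β] {Γ₁ Γ₂ : List (ℕ × β)} {x : ℕ}
    (h : x ∈ domG (addG Γ₁ Γ₂)) : x ∈ domG Γ₁ ∨ x ∈ domG Γ₂ := by
  rw [domG_addG, List.mem_append] at h
  exact h.imp_right fun h => (List.mem_filter.1 h).1

theorem mem_domG_sumG {β : Type} [Zero β] [Add β] {l : List (List (ℕ × β))} {x : ℕ}
    (h : x ∈ domG (sumG l)) : ∃ Γ ∈ l, x ∈ domG Γ := by
  induction l with
  | nil => simp [sumG, domG] at h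
  | cons Γ l ih =>
    rcases mem_domG_addG h with h | h
    · exact ⟨Γ, by simp, h⟩
    · obtain ⟨Δ, hΔ, hx⟩ := ih h
      exact ⟨Δ, by simp [hΔ], hx⟩

theorem Infer.domG_subset_allVars {M : Term} {Γ : Env} {σ : Ty2} (h : Infer M Γ σ) :
    ∀ x ∈ domG Γ, x ∈ M.allVars := by
  have herase (Γ : Env) (x z : ℕ) (h : z ∈ domG (eraseG Γ x)) : z ∈ domG Γ :=
    (List.filter_sublist.map _).subset h
  induction h with
  | var x α => simp [domG, Term.allVars]
  | lamLolly x _ _ _ ih =>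
    exact fun z hz => Finset.mem_insert_of_mem (ih z (herase _ _ _ hz))
  | lamArrow x _ _ _ _ ih =>
    exact fun z hz => Finset.mem_insert_of_mem (ih z (herase _ _ _ hz))
  | appVar _ _ _ _ S _ _ _ _ _ _ _ ih₁ ih₂ =>
    intro z hz
    rw [domG_envApplyS] at hz
    exact Finset.mem_union.2 ((mem_domG_addG hz).imp (ih₁ z) (ih₂ z))
  | appArrow l _ S _ _ _ _ _ _ _ ih₁ ih₂ =>
    intro z hz
    rw [domG_envApplyS] at hz
    refine Finset.mem_union.2 ((mem_domG_addG hz).imp (ih₁ z) fun h => ?_)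
    obtain ⟨Γ, hΓ, hz⟩ := mem_domG_sumG h
    obtain ⟨p, hp, rfl⟩ := List.mem_map.1 hΓ
    exact ih₂ p hp z hz
  | appLolly _ _ _ S _ _ _ _ ih₁ ih₂ =>
    intro z hz
    rw [domG_envApplyS] at hz
    exact Finset.mem_union.2 ((mem_domG_addG hz).imp (ih₁ z) (ih₂ z))

/-- Renaming a free variable to a variable that is not bound in the term merges the
corresponding declarations and leaves the inferred type unchanged. -/
theorem Infer.rename {M : Term} {Γ : Env} {σ : Ty2} (h : Infer M Γ σ) (z y : ℕ)
    (hy : y ∉ M.boundVars) :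
    ∃ Δ : Env, Infer (M.subst z (.var y)) Δ σ ∧ flat Δ = (flat Γ).map (renamePair z y) := by
  induction h with
  | var x α =>
    refine ⟨[(if x = z then y else x, {LTy.var α})], ?_, by simp [flat, renamePair]⟩
    by_cases h : x = z
    · simpa [Term.subst, h] using Infer.var y α
    · simpa [Term.subst, h] using Infer.var x α
  | @lamLolly M₁ Γ₁ σ₁ x τ h hm ih =>
    simp only [Term.boundVars, Finset.mem_insert, not_or] at hy
    by_cases hx : x = z
    · subst hx
      refine ⟨eraseG Γ₁ x, ?_, (map_renamePair_of_notMem y (notMem_domG_eraseG Γ₁ x)).symm⟩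
      simpa [Term.subst] using h.lamLolly x τ hm
    · obtain ⟨Δ, hΔ, hf⟩ := ih hy.2
      refine ⟨eraseG Δ x, ?_, flat_eraseG_rename hf hx (Ne.symm hy.1)⟩
      rw [h.proper.mem_iff, ← lookupG_rename h.proper hΔ.proper hf hx (Ne.symm hy.1),
        ← hΔ.proper.mem_iff] at hm
      simpa [Term.subst, hx] using hΔ.lamLolly x τ hm
  | @lamArrow M₁ Γ₁ σ₁ x A h hm hA ih =>
    simp only [Term.boundVars, Finset.mem_insert, not_or] at hy
    by_cases hx : x = z
    · subst hx
      refine ⟨eraseG Γ₁ x, ?_, (map_renamePair_of_notMem y (notMem_domG_eraseG Γ₁ x)).symm⟩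
      simpa [Term.subst] using h.lamArrow x A hm hA
    · obtain ⟨Δ, hΔ, hf⟩ := ih hy.2
      refine ⟨eraseG Δ x, ?_, flat_eraseG_rename hf hx (Ne.symm hy.1)⟩
      rw [h.proper.mem_iff, ← lookupG_rename h.proper hΔ.proper hf hx (Ne.symm hy.1),
        ← hΔ.proper.mem_iff] at hm
      simpa [Term.subst, hx] using hΔ.lamArrow x A hm hA
  | appVar α₁ τ₂ α₂ α₃ S h₁ h₂ hd hα₂ hα₃ hne hS ih₁ ih₂ =>
    simp only [Term.boundVars, Finset.mem_union, not_or] at hy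
    obtain ⟨Δ₁, hΔ₁, hf₁⟩ := ih₁ hy.1
    obtain ⟨Δ₂, hΔ₂, hf₂⟩ := ih₂ hy.2
    rw [← tvOf_rename hf₁, ← tvOf_rename hf₂] at hd hα₂ hα₃
    refine ⟨_, hΔ₁.appVar α₁ τ₂ α₂ α₃ S hΔ₂ hd hα₂ hα₃ hne hS,
      flat_envApplyS_rename S z y ?_⟩
    rw [hΔ₁.proper.flat_addG hΔ₂.proper, h₁.proper.flat_addG h₂.proper, hf₁, hf₂,
      Multiset.map_add]
  | @appArrow M₁ M₂ Γ₁ σ₁ l ts S h₁ h₂ hlen hl hpw hd hS ih₁ ih₂ =>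
    simp only [Term.boundVars, Finset.mem_union, not_or] at hy
    obtain ⟨Δ₁, hΔ₁, hf₁⟩ := ih₁ hy.1
    have ih₂' := fun p hp => ih₂ p hp hy.2
    choose! g hg hf using ih₂'
    have hsnd : (l.map fun p => (g p, p.2)).map Prod.snd = l.map Prod.snd := by
      simp [Function.comp_def]
    refine ⟨_, hΔ₁.appArrow (l.map fun p => (g p, p.2)) ts S ?_ (by simpa using hlen)
      (by simpa using hl) ?_ ?_ (by rwa [hsnd]), flat_envApplyS_rename S z y ?_⟩
    · intro q hq
      obtain ⟨p, hp, rfl⟩ := List.mem_map.1 hq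
      exact hg p hp
    · rw [List.pairwise_map]
      refine hpw.imp_of_mem fun {p q} hp hq hpq => ?_
      simpa only [tvOf_rename (hf p hp), tvOf_rename (hf q hq)] using hpq
    · intro q hq
      obtain ⟨p, hp, rfl⟩ := List.mem_map.1 hq
      simpa only [tvOf_rename (hf p hp), tvOf_rename hf₁] using hd p hp
    · have hΓ : ∀ Γ ∈ l.map Prod.fst, Env.Proper Γ := by
        intro Γ hΓ
        obtain ⟨p, hp, rfl⟩ := List.mem_map.1 hΓ
        exact (h₂ p hp).proper
      have hΔ : ∀ Δ ∈ (l.map fun p => (g p, p.2)).map Prod.fst, Env.Proper Δ := by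
        intro Δ hΔ
        simp only [List.map_map, List.mem_map] at hΔ
        obtain ⟨p, hp, rfl⟩ := hΔ
        exact (hg p hp).proper
      rw [hΔ₁.proper.flat_addG (Proper.sumG hΔ), h₁.proper.flat_addG (Proper.sumG hΓ),
        flat_sumG hΔ, flat_sumG hΓ, hf₁, Multiset.map_add]
      congr 1
      rw [← Multiset.coe_mapAddMonoidHom, map_list_sum]
      simp only [List.map_map]
      congr 1
      refine List.map_congr_left fun p hp => ?_
      exact hf p hp
  | appLolly τ σ₁ τ₂ S h₁ h₂ hd hS ih₁ ih₂ =>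
    simp only [Term.boundVars, Finset.mem_union, not_or] at hy
    obtain ⟨Δ₁, hΔ₁, hf₁⟩ := ih₁ hy.1
    obtain ⟨Δ₂, hΔ₂, hf₂⟩ := ih₂ hy.2
    rw [← tvOf_rename hf₁, ← tvOf_rename hf₂] at hd
    refine ⟨_, hΔ₁.appLolly τ σ₁ τ₂ S hΔ₂ hd hS, flat_envApplyS_rename S z y ?_⟩
    rw [hΔ₁.proper.flat_addG hΔ₂.proper, h₁.proper.flat_addG h₂.proper, hf₁, hf₂,
      Multiset.map_add]

/-- If `T(M) = (Γ, σ)` with `Γ ≡ (Γ', y₁:τ⃗₁, y₂:τ⃗₂)` and `y` does not occur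
in `M`, then `T(M[y/y₁, y/y₂]) = (Γ'', σ)` for some `Γ'' ≡ (Γ', y:τ⃗₁ ∩ τ⃗₂)`. -/
theorem infer_contract (M : Term) (Γ Γ' : Env) (σ : Ty2) (y₁ y₂ y : ℕ)
    (A B : Multiset LTy)
    (h : Infer M Γ σ)
    (hperm : Γ.Perm (Γ' ++ [(y₁, A), (y₂, B)]))
    (hy : y ∉ M.allVars) :
    ∃ Γ'' : Env,
      Infer ((M.subst y₁ (.var y)).subst y₂ (.var y)) Γ'' σ ∧
      Γ''.Perm (Γ' ++ [(y, A + B)]) := by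
  have hΓ := h.proper
  have hΓ' := hΓ.perm hperm
  have hyΓ : y ∉ domG (Γ' ++ [(y₁, A), (y₂, B)]) := fun hm =>
    hy (h.domG_subset_allVars y ((hperm.map _).mem_iff.2 hm))
  have hyb : y ∉ M.boundVars := fun hm => hy (M.boundVars_subset_allVars hm)
  obtain ⟨Δ₁, hΔ₁, hf₁⟩ := h.rename y₁ y hyb
  obtain ⟨Δ₂, hΔ₂, hf₂⟩ := hΔ₁.rename y₂ y (by rwa [Term.boundVars_subst_var])
  refine ⟨Δ₂, hΔ₂, hΔ₂.proper.perm_of_flat_eq ?_ ?_⟩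
  · obtain ⟨hn, hz⟩ := hΓ'
    constructor
    · simp only [domG, List.map_append, List.nodup_append, List.mem_append, List.map_cons]
        at hn hyΓ ⊢
      grind
    · intro p hp
      rcases List.mem_append.1 hp with hp | hp
      · exact hz p (List.mem_append_left _ hp)
      · have := hz (y₁, A) (by simp)
        simp_all
  · have hn := hΓ'.1
    simp only [domG, List.map_append, List.nodup_append, List.mem_append, List.map_cons] at hn hyΓ
    have h₁ : y₁ ∉ domG Γ' := by
      simp only [domG]
      grind
    have h₂ : y₂ ∉ domG Γ' := by
      simp only [domG]
      grind
    have h₁₂ : y₁ ≠ y₂ := by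
      grind
    rw [hf₂, hf₁, flat_perm hperm, flat_append, flat_append, Multiset.map_add, Multiset.map_add,
      map_renamePair_of_notMem y h₁, map_renamePair_of_notMem y h₂]
    simp [flat, renamePair, Function.comp_def, Ne.symm h₁₂]
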